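/- Let k ∈ {3,4,5} and ε > 0. There is a constant C > 0 such that for every real T ≥ 10 and every real y with 2 ≤ y ≤ T, one has |∫_T^{2T} S₄(x) dx| ≤ C · T^{3/4+9k/8+ε} y^{4^{k−2} − 5/4 + k/8}, where S₄(x) = x^{9k/8} ∑_{i ∈ {0,1}^{k−1}} ∑ (c_{n₁}⋯c_{n_k}/(n₁⋯n_k)^{7/8}) cos(8π α(n;i) x^{1/4} − πβ(i)/4), the inner sum running over k-tuples (n₁,…,n_k) of positive integers with y < n₁ < 2ky, n_j ≤ y for 2 ≤ j ≤ k, and α(n;i) ≠ 0. -/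

import Mathlib

open scoped Classical
open Real Finset

/-- `α(n; i) = n₁^{1/4} + (−1)^{i₁} n₂^{1/4} + ⋯ + (−1)^{i_{k−1}} n_k^{1/4}`, encoded with a sign
bit for every index; the leading `+1` sign corresponds to the hypothesis `i 0 = false`. -/
noncomputable def alphaRS {k : ℕ} (n : Fin k → ℕ) (i : Fin k → Bool) : ℝ :=
  ∑ j, (if i j then (-1 : ℝ) else 1) * (n j : ℝ) ^ ((1 : ℝ) / 4)

/-- `β(i) = 1 + (−1)^{i₁} + ⋯ + (−1)^{i_{k−1}}`. -/
noncomputable def betaRS {k : ℕ} (i : Fin k → Bool) : ℝ :=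
  ∑ j, (if i j then (-1 : ℝ) else 1)

theorem exists_intCast_eq_of_isIntegral_of_fixed {L : Type*} [Field L] [Algebra ℚ L]
    [IsGalois ℚ L] {x : L} (hx : IsIntegral ℤ x) (hfix : ∀ σ : L ≃ₐ[ℚ] L, σ x = x) :
    ∃ z : ℤ, (z : L) = x := by
  obtain ⟨q, hq⟩ := (InfiniteGalois.mem_range_algebraMap_iff_fixed (k := ℚ) x).2 hfix
  have hqi : IsIntegral ℤ q := by
    rw [← hq] at hx
    exact (isIntegral_algebraMap_iff (algebraMap ℚ L).injective).1 hx
  obtain ⟨z, hz⟩ := IsIntegrallyClosed.isIntegral_iff.1 hqi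
  refine ⟨z, ?_⟩
  rw [← hq, ← hz]
  simp

/-- The nonzero fourth powers of the formal conjugates `r₀ + ω₁ r₁ + ⋯ + ωₘ rₘ`, with
`ω₁, …, ωₘ` fourth roots of unity. -/
noncomputable def conjFourthPowers {L : Type*} [Field L] {m : ℕ} (r : Fin (m + 1) → L) :
    Finset L :=
  ((Fintype.piFinset (fun j : Fin (m + 1) =>
    if j = 0 then ({1} : Finset L) else Polynomial.nthRootsFinset 4 (1 : L))).image
      (fun w => (∑ j, w j * r j) ^ 4)).erase 0

section ConjFourthPowers

variable {L : Type*} [Field L] {m : ℕ} {r : Fin (m + 1) → L}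

theorem mem_conjFourthPowers {x : L} :
    x ∈ conjFourthPowers r ↔
      x ≠ 0 ∧ ∃ w : Fin (m + 1) → L, (∀ j, w j ^ 4 = 1) ∧ x = (∑ j, w j * r j) ^ 4 := by
  simp only [conjFourthPowers, Finset.mem_erase, Finset.mem_image, Fintype.mem_piFinset]
  refine and_congr_right fun _ => ⟨?_, ?_⟩
  · rintro ⟨w, hw, rfl⟩
    refine ⟨w, fun j => ?_, rfl⟩
    have := hw j
    split_ifs at this
    · simp [Finset.mem_singleton.1 this]
    · exact (Polynomial.mem_nthRootsFinset (by norm_num) _).1 this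
  · rintro ⟨w, hw, rfl⟩
    have h0 : w 0 ≠ 0 := by
      intro h
      have := hw 0
      simp [h] at this
    refine ⟨fun j => w j / w 0, fun j => ?_, ?_⟩
    · split_ifs with hj
      · simp [hj, h0]
      · rw [Polynomial.mem_nthRootsFinset (by norm_num), div_pow, hw, hw, div_one]
    · have : ∑ j, w j / w 0 * r j = (∑ j, w j * r j) / w 0 := by
        rw [Finset.sum_div]
        exact Finset.sum_congr rfl fun j _ => by ring
      rw [this, div_pow, hw, div_one]

theorem card_conjFourthPowers_le : #(conjFourthPowers r) ≤ 4 ^ m := by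
  refine (Finset.card_erase_le).trans (Finset.card_image_le.trans ?_)
  rw [Fintype.card_piFinset, Fin.prod_univ_succ]
  simp only [if_true, Finset.card_singleton, one_mul, Fin.succ_ne_zero, if_false,
    Finset.prod_const, Finset.card_univ, Fintype.card_fin]
  gcongr
  exact (Multiset.toFinset_card_le _).trans (Polynomial.card_nthRoots 4 1)

theorem map_mem_conjFourthPowers [Algebra ℚ L] {n : Fin (m + 1) → ℕ}
    (hr : ∀ j, r j ^ 4 = (n j : L)) (σ : L ≃ₐ[ℚ] L) {x : L} (hx : x ∈ conjFourthPowers r) :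
    σ x ∈ conjFourthPowers r := by
  rw [mem_conjFourthPowers] at hx ⊢
  obtain ⟨hx0, w, hw, rfl⟩ := hx
  refine ⟨(map_ne_zero σ).2 hx0, fun j => if r j = 0 then 1 else σ (w j) * (σ (r j) / r j), ?_, ?_⟩
  · intro j
    dsimp only
    split_ifs with h
    · simp
    · have h4 : (n j : L) ≠ 0 := by rw [← hr]; exact pow_ne_zero _ h
      rw [mul_pow, div_pow, ← map_pow, ← map_pow, hw, hr, map_natCast, map_one, div_self h4,
        one_mul]
  · rw [map_pow, map_sum]
    congr 1
    refine Finset.sum_congr rfl fun j _ => ?_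
    dsimp only
    split_ifs with h
    · simp [h]
    · rw [map_mul]
      field_simp

theorem exists_intCast_eq_prod_conjFourthPowers [Algebra ℚ L] [IsGalois ℚ L]
    {n : Fin (m + 1) → ℕ} (hr : ∀ j, r j ^ 4 = (n j : L)) :
    ∃ z : ℤ, (z : L) = ∏ x ∈ conjFourthPowers r, x := by
  refine exists_intCast_eq_of_isIntegral_of_fixed ?_ fun σ => ?_
  · refine IsIntegral.prod _ fun x hx => ?_
    obtain ⟨-, w, hw, rfl⟩ := mem_conjFourthPowers.1 hx
    refine (IsIntegral.sum _ fun j _ => ?_).pow 4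
    refine IsIntegral.mul (IsIntegral.of_pow (n := 4) (by norm_num) ?_)
      (IsIntegral.of_pow (n := 4) (by norm_num) ?_)
    · rw [hw]; exact isIntegral_one
    · rw [hr]
      simpa using isIntegral_algebraMap (R := ℤ) (A := L) (x := (n j : ℤ))
  · have hmaps : Set.MapsTo σ (conjFourthPowers r) (conjFourthPowers r) :=
      fun x hx => map_mem_conjFourthPowers hr σ hx
    rw [map_prod]
    exact Finset.prod_nbij σ hmaps σ.injective.injOn
      (Finset.surjOn_of_injOn_of_card_le _ hmaps σ.injective.injOn le_rfl) fun _ _ => rfl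

end ConjFourthPowers

theorem isGalois_algebraicClosure (F E : Type*) [Field F] [PerfectField F] [Field E]
    [Algebra F E] [IsAlgClosed E] : IsGalois F (algebraicClosure F E) where
  to_isSeparable := Algebra.IsAlgebraic.isSeparable_of_perfectField
  to_normal := IsAlgClosure.normal F (algebraicClosure F E)

theorem one_le_abs_sum_mul_pow {m : ℕ} (n : Fin (m + 1) → ℕ) (e : Fin (m + 1) → ℝ)
    (he : ∀ j, e j ^ 4 = 1) {B : ℝ} (hB : ∑ j, (n j : ℝ) ^ ((1 : ℝ) / 4) ≤ B) (hB1 : 1 ≤ B)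
    (h0 : ∑ j, e j * (n j : ℝ) ^ ((1 : ℝ) / 4) ≠ 0) :
    1 ≤ |∑ j, e j * (n j : ℝ) ^ ((1 : ℝ) / 4)| * B ^ (4 ^ m - 1) := by
  set a := ∑ j, e j * (n j : ℝ) ^ ((1 : ℝ) / 4) with ha
  let L := algebraicClosure ℚ ℂ
  have : IsGalois ℚ L := isGalois_algebraicClosure ℚ ℂ
  have hroot (j) : ((n j : ℝ) ^ ((1 : ℝ) / 4)) ^ 4 = n j := by
    rw [← Real.rpow_natCast, ← Real.rpow_mul (by positivity)]
    norm_num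
  have hmem (x : ℂ) (N : ℕ) (hx : x ^ 4 = N) : x ∈ algebraicClosure ℚ ℂ := by
    rw [mem_algebraicClosure_iff']
    refine IsIntegral.of_pow (n := 4) (by norm_num) ?_
    rw [hx]
    simpa using isIntegral_algebraMap (R := ℚ) (A := ℂ) (x := (N : ℚ))
  let r : Fin (m + 1) → L := fun j => ⟨(((n j : ℝ) ^ ((1 : ℝ) / 4) : ℝ) : ℂ),
    hmem _ (n j) (by exact_mod_cast congrArg Complex.ofReal (hroot j))⟩
  let u : Fin (m + 1) → L := fun j => ⟨(e j : ℂ),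
    hmem _ 1 (by exact_mod_cast congrArg Complex.ofReal (he j))⟩
  have hr (j) : r j ^ 4 = (n j : L) := by
    apply Subtype.ext
    simpa [r] using congrArg Complex.ofReal (hroot j)
  have hu (j) : u j ^ 4 = 1 := by
    apply Subtype.ext
    simpa [u] using congrArg Complex.ofReal (he j)
  have hcoe (w : Fin (m + 1) → L) :
      (((∑ j, w j * r j) ^ 4 : L) : ℂ) =
        (∑ j, (w j : ℂ) * (((n j : ℝ) ^ ((1 : ℝ) / 4) : ℝ) : ℂ)) ^ 4 := by
    simp only [SubmonoidClass.coe_pow, AddSubmonoidClass.coe_finsetSum, MulMemClass.coe_mul, r]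
  have hacoe : (((∑ j, u j * r j) ^ 4 : L) : ℂ) = (a : ℂ) ^ 4 := by
    rw [hcoe, ha]; push_cast; rfl
  have haS : (∑ j, u j * r j) ^ 4 ∈ conjFourthPowers r := by
    refine mem_conjFourthPowers.2 ⟨fun h => ?_, u, hu, rfl⟩
    rw [h] at hacoe
    have : (a : ℂ) ^ 4 = 0 := by rw [← hacoe]; rfl
    exact h0 (by exact_mod_cast pow_eq_zero_iff (four_ne_zero) |>.1 this)
  have hbound (x : L) (hx : x ∈ conjFourthPowers r) : ‖(x : ℂ)‖ ≤ B ^ 4 := by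
    obtain ⟨-, w, hw, rfl⟩ := mem_conjFourthPowers.1 hx
    rw [hcoe, norm_pow]
    gcongr
    refine (norm_sum_le _ _).trans (le_trans (le_of_eq ?_) hB)
    refine Finset.sum_congr rfl fun j _ => ?_
    have hwn : ‖(w j : ℂ)‖ = 1 := by
      have h4 : (w j : ℂ) ^ 4 = 1 := by exact_mod_cast congrArg Subtype.val (hw j)
      refine (pow_eq_one_iff_of_nonneg (norm_nonneg _) (four_ne_zero)).1 ?_
      rw [← norm_pow, h4, norm_one]
    rw [norm_mul, hwn, one_mul, Complex.norm_real, Real.norm_of_nonneg (by positivity)]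
  obtain ⟨z, hz⟩ := exists_intCast_eq_prod_conjFourthPowers hr
  have hz0 : z ≠ 0 := by
    rintro rfl
    rw [Int.cast_zero, eq_comm, Finset.prod_eq_zero_iff] at hz
    obtain ⟨x, hx, rfl⟩ := hz
    exact (mem_conjFourthPowers.1 hx).1 rfl
  have hone : 1 ≤ ‖((∏ x ∈ conjFourthPowers r, x : L) : ℂ)‖ := by
    rw [← hz]
    have : (((z : L)) : ℂ) = (z : ℂ) := by simp
    rw [this, Complex.norm_intCast]
    exact_mod_cast Int.one_le_abs hz0
  rw [← Finset.mul_prod_erase _ _ haS, MulMemClass.coe_mul, norm_mul, hacoe, norm_pow,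
    Complex.norm_real, Real.norm_eq_abs] at hone
  have hrest : ‖((∏ x ∈ (conjFourthPowers r).erase ((∑ j, u j * r j) ^ 4), x : L) : ℂ)‖ ≤
      (B ^ 4) ^ (4 ^ m - 1) := by
    rw [SubmonoidClass.coe_finsetProd, norm_prod]
    refine (Finset.prod_le_prod (fun _ _ => norm_nonneg _) fun x hx =>
      hbound x (Finset.mem_of_mem_erase hx)).trans ?_
    rw [Finset.prod_const]
    refine pow_le_pow_right₀ (one_le_pow₀ hB1) ?_
    rw [Finset.card_erase_of_mem haS]
    exact Nat.sub_le_sub_right card_conjFourthPowers_le 1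
  have h4 : 1 ≤ (|a| * B ^ (4 ^ m - 1)) ^ 4 := by
    calc 1 ≤ |a| ^ 4 * (B ^ 4) ^ (4 ^ m - 1) :=
          hone.trans (mul_le_mul_of_nonneg_left hrest (by positivity))
      _ = _ := by rw [mul_pow, ← pow_mul, ← pow_mul, mul_comm 4]
  exact (one_le_pow_iff_of_nonneg (by positivity) (by norm_num)).1 h4

theorem abs_integral_rpow_mul_cos_le {a α φ T : ℝ} (ha : 0 ≤ a) (hα : α ≠ 0) (hT : 0 < T) :
    |∫ x in T..(2 * T), x ^ a * Real.cos (8 * π * α * x ^ ((1 : ℝ) / 4) - φ)| ≤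
      (2 * T) ^ (a + 3 / 4) * (1 / |α|) := by
  have hpos {x : ℝ} (hx : x ∈ Set.uIcc T (2 * T)) : 0 < x := by
    rw [Set.uIcc_of_le (by linarith)] at hx
    linarith [hx.1]
  have hcont (b : ℝ) : ContinuousOn (fun x : ℝ => x ^ b) (Set.uIcc T (2 * T)) :=
    fun x hx => (Real.continuousAt_rpow_const _ _ (Or.inl (hpos hx).ne')).continuousWithinAt
  set θ : ℝ → ℝ := fun x => 8 * π * α * x ^ ((1 : ℝ) / 4) - φ with hθ
  have hθc : ContinuousOn θ (Set.uIcc T (2 * T)) :=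
    ((hcont (1 / 4)).const_mul _).sub continuousOn_const
  have hu : ∀ x ∈ Set.uIcc T (2 * T),
      HasDerivAt (fun x : ℝ => x ^ (a + 3 / 4)) ((a + 3 / 4) * x ^ (a + 3 / 4 - 1)) x :=
    fun x hx => Real.hasDerivAt_rpow_const (Or.inl (hpos hx).ne')
  have hv : ∀ x ∈ Set.uIcc T (2 * T), HasDerivAt (fun x => Real.sin (θ x))
      (Real.cos (θ x) * (8 * π * α * (1 / 4 * x ^ ((1 : ℝ) / 4 - 1)))) x := fun x hx =>
    (((Real.hasDerivAt_rpow_const (Or.inl (hpos hx).ne')).const_mul _).sub_const _).sin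
  have hu'i : IntervalIntegrable (fun x : ℝ => (a + 3 / 4) * x ^ (a + 3 / 4 - 1))
      MeasureTheory.volume T (2 * T) := ((hcont _).const_mul _).intervalIntegrable
  have hv'i : IntervalIntegrable
      (fun x : ℝ => Real.cos (θ x) * (8 * π * α * (1 / 4 * x ^ ((1 : ℝ) / 4 - 1))))
      MeasureTheory.volume T (2 * T) :=
    ((Real.continuous_cos.comp_continuousOn hθc).mul
      (((hcont _).const_mul _).const_mul _)).intervalIntegrable
  have hparts := intervalIntegral.integral_mul_deriv_eq_deriv_mul hu hv hu'i hv'i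
  have hftc : ∫ x in T..(2 * T), (a + 3 / 4) * x ^ (a + 3 / 4 - 1) =
      (2 * T) ^ (a + 3 / 4) - T ^ (a + 3 / 4) :=
    intervalIntegral.integral_eq_sub_of_hasDerivAt hu hu'i
  have hrem : |∫ x in T..(2 * T), (a + 3 / 4) * x ^ (a + 3 / 4 - 1) * Real.sin (θ x)| ≤
      (2 * T) ^ (a + 3 / 4) - T ^ (a + 3 / 4) := by
    rw [← hftc, ← Real.norm_eq_abs]
    refine intervalIntegral.norm_integral_le_of_norm_le (by linarith)
      (Filter.Eventually.of_forall fun x hx => ?_) hu'i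
    have : 0 < x := hT.trans hx.1
    rw [norm_mul, Real.norm_eq_abs, Real.norm_eq_abs, abs_of_nonneg (by positivity)]
    exact mul_le_of_le_one_right (by positivity) (Real.abs_sin_le_one _)
  have hlhs : ∫ x in T..(2 * T), x ^ (a + 3 / 4) *
      (Real.cos (θ x) * (8 * π * α * (1 / 4 * x ^ ((1 : ℝ) / 4 - 1)))) =
      (2 * π * α) * ∫ x in T..(2 * T), x ^ a * Real.cos (θ x) := by
    rw [← intervalIntegral.integral_const_mul]
    refine intervalIntegral.integral_congr fun x hx => ?_
    have h : x ^ a = x ^ (a + 3 / 4) * x ^ ((1 : ℝ) / 4 - 1) := by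
      rw [← Real.rpow_add (hpos hx)]
      ring_nf
    simp only [h]
    ring
  have hsin (x : ℝ) (hx : 0 < x) :
      |x ^ (a + 3 / 4) * Real.sin (θ x)| ≤ x ^ (a + 3 / 4) := by
    rw [abs_mul, abs_of_nonneg (by positivity)]
    exact mul_le_of_le_one_right (by positivity) (Real.abs_sin_le_one _)
  have hmain : |(2 * π * α) * ∫ x in T..(2 * T), x ^ a * Real.cos (θ x)| ≤
      2 * (2 * T) ^ (a + 3 / 4) := by
    rw [← hlhs, hparts]
    have h1 := abs_sub ((2 * T) ^ (a + 3 / 4) * Real.sin (θ (2 * T)) -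
      T ^ (a + 3 / 4) * Real.sin (θ T))
      (∫ x in T..(2 * T), (a + 3 / 4) * x ^ (a + 3 / 4 - 1) * Real.sin (θ x))
    have h2 := abs_sub ((2 * T) ^ (a + 3 / 4) * Real.sin (θ (2 * T)))
      (T ^ (a + 3 / 4) * Real.sin (θ T))
    have h3 := hsin (2 * T) (by linarith)
    have h4 := hsin T hT
    linarith
  rw [abs_mul, abs_mul, abs_of_pos Real.two_pi_pos] at hmain
  have hα' : 0 < |α| := abs_pos.2 hα
  rw [mul_one_div, le_div_iff₀ hα']
  have hI := abs_nonneg (∫ x in T..(2 * T), x ^ a * Real.cos (θ x))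
  have := mul_nonneg hα'.le hI
  change |∫ x in T..(2 * T), x ^ a * Real.cos (θ x)| * |α| ≤ _
  nlinarith [Real.pi_gt_three]

theorem sum_Icc_rpow_neg_le (N : ℕ) :
    ∑ n ∈ Finset.Icc 1 N, (n : ℝ) ^ (-(7 : ℝ) / 8) ≤ 8 * (N : ℝ) ^ ((1 : ℝ) / 8) := by
  induction N with
  | zero => simp
  | succ N ih =>
    rw [Finset.sum_Icc_succ_top (by omega)]
    set a : ℝ := ((N + 1 : ℕ) : ℝ) ^ ((1 : ℝ) / 8) with ha
    set b : ℝ := (N : ℝ) ^ ((1 : ℝ) / 8) with hb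
    have hapos : 0 < a := by positivity
    have hb0 : 0 ≤ b := by positivity
    have hba : b ≤ a := Real.rpow_le_rpow (by positivity) (by push_cast; linarith) (by norm_num)
    have ha8 : a ^ 8 = N + 1 := by
      rw [ha, ← Real.rpow_natCast, ← Real.rpow_mul (by positivity)]
      norm_num
    have hb8 : b ^ 8 = N := by
      rw [hb, ← Real.rpow_natCast, ← Real.rpow_mul (by positivity)]
      norm_num
    have hterm : ((N + 1 : ℕ) : ℝ) ^ (-(7 : ℝ) / 8) = 1 / a ^ 7 := by
      rw [ha, ← Real.rpow_natCast, ← Real.rpow_mul (by positivity), one_div,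
        ← Real.rpow_neg (by positivity)]
      norm_num
    have key : 1 ≤ (a - b) * (8 * a ^ 7) := by
      have h1 : (1 : ℝ) = (a - b) * (∑ i ∈ Finset.range 8, a ^ i * b ^ (7 - i)) := by
        simp only [Finset.sum_range_succ, Finset.sum_range_zero]
        norm_num
        ring_nf
        linarith
      have h2 : ∑ i ∈ Finset.range 8, a ^ i * b ^ (7 - i) ≤ ∑ i ∈ Finset.range 8, a ^ 7 := by
        refine Finset.sum_le_sum fun i hi => ?_
        calc a ^ i * b ^ (7 - i) ≤ a ^ i * a ^ (7 - i) := by gcongr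
          _ = a ^ 7 := by
            rw [← pow_add]
            congr 1
            have := Finset.mem_range.1 hi
            omega
      rw [h1]
      refine (mul_le_mul_of_nonneg_left h2 (by linarith)).trans (le_of_eq ?_)
      simp
    have : 1 / a ^ 7 ≤ 8 * (a - b) := by
      rw [div_le_iff₀ (by positivity)]
      linarith
    rw [hterm]
    linarith

theorem sum_one_div_abs_rpow_add_le {s : Finset ℕ} {M A D : ℝ} (hM : 0 < M) (hD : 0 ≤ D)
    (hs : ∀ n ∈ s, 1 ≤ n ∧ (n : ℝ) ≤ M)
    (hA : ∀ n ∈ s, (n : ℝ) ^ ((1 : ℝ) / 4) + A ≠ 0 → 1 / |(n : ℝ) ^ ((1 : ℝ) / 4) + A| ≤ D) :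
    ∑ n ∈ s, (if (n : ℝ) ^ ((1 : ℝ) / 4) + A ≠ 0 then
      1 / |(n : ℝ) ^ ((1 : ℝ) / 4) + A| else 0) ≤ D + #s * (8 * M) := by
  set f : ℕ → ℝ := fun n => (n : ℝ) ^ ((1 : ℝ) / 4) with hf
  have hf4 (n : ℕ) : f n ^ 4 = n := by
    rw [hf, ← Real.rpow_natCast, ← Real.rpow_mul (by positivity)]
    norm_num
  have hf0 (n : ℕ) : 0 ≤ f n := by positivity
  have hf3 {n : ℕ} (hn : n ∈ s) : f n ^ 3 ≤ M := by
    obtain ⟨h1, h2⟩ := hs n hn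
    have h1' : 1 ≤ f n := Real.one_le_rpow (by exact_mod_cast h1) (by norm_num)
    calc f n ^ 3 ≤ f n ^ 4 := pow_le_pow_right₀ h1' (by norm_num)
      _ ≤ M := by rw [hf4]; exact h2
  have hgap {p q : ℕ} (hp : p ∈ s) (hq : q ∈ s) (hpq : q < p) : 1 / (4 * M) ≤ f p - f q := by
    have hle : f q ≤ f p := Real.rpow_le_rpow (by positivity) (by exact_mod_cast hpq.le)
      (by norm_num)
    have h1 : (1 : ℝ) ≤ f p ^ 4 - f q ^ 4 := by
      rw [hf4, hf4, le_sub_iff_add_le']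
      exact_mod_cast hpq
    have h2 : f p ^ 4 - f q ^ 4 =
        (f p - f q) * (f p ^ 3 + f p ^ 2 * f q + f p * f q ^ 2 + f q ^ 3) := by ring
    have h3 : f p ^ 3 + f p ^ 2 * f q + f p * f q ^ 2 + f q ^ 3 ≤ 4 * M := by
      have e1 : f p ^ 2 * f q ≤ f p ^ 2 * f p := by gcongr
      have e2 : f p * f q ^ 2 ≤ f p * f p ^ 2 := by have := hf0 p; have := hf0 q; gcongr
      have e3 : f q ^ 3 ≤ f p ^ 3 := by have := hf0 q; gcongr
      have := hf3 hp
      nlinarith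
    rw [div_le_iff₀ (by positivity)]
    rw [h2] at h1
    exact h1.trans (mul_le_mul_of_nonneg_left h3 (by linarith))
  have hcard : #(s.filter fun n => |f n + A| < 1 / (8 * M)) ≤ 1 := by
    rw [Finset.card_le_one]
    have h8 : 1 / (4 * M) = 1 / (8 * M) + 1 / (8 * M) := by field_simp; norm_num
    intro p hp q hq
    rw [Finset.mem_filter, abs_lt] at hp hq
    by_contra hne
    rcases lt_or_gt_of_ne hne with h | h
    · have := hgap hq.1 hp.1 h
      linarith [hp.2.1, hq.2.2]
    · have := hgap hp.1 hq.1 h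
      linarith [hp.2.2, hq.2.1]
  have hterm : ∀ n ∈ s, (if f n + A ≠ 0 then 1 / |f n + A| else 0) ≤
      (if |f n + A| < 1 / (8 * M) then D else 0) + 8 * M := by
    intro n hn
    by_cases h0 : f n + A ≠ 0
    · rw [if_pos h0]
      split_ifs with h
      · linarith [hA n hn h0]
      · rw [not_lt] at h
        rw [zero_add]
        exact (one_div_le_one_div_of_le (by positivity) h).trans (le_of_eq (by simp))
    · rw [if_neg h0]
      split_ifs <;> positivity
  refine (Finset.sum_le_sum hterm).trans ?_
  rw [Finset.sum_add_distrib, ← Finset.sum_filter, Finset.sum_const, Finset.sum_const,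
    nsmul_eq_mul, nsmul_eq_mul]
  have : (#(s.filter fun n => |f n + A| < 1 / (8 * M)) : ℝ) ≤ 1 := by exact_mod_cast hcard
  nlinarith

theorem sum_piFinset_cons {m : ℕ} {R : Type*} [AddCommMonoid R] (s : Finset ℕ) (t : Finset ℕ)
    (F : (Fin (m + 1) → ℕ) → R) :
    ∑ n ∈ Fintype.piFinset (fun j : Fin (m + 1) => if (j : ℕ) = 0 then s else t), F n =
      ∑ r ∈ Fintype.piFinset (fun _ : Fin m => t), ∑ a ∈ s, F (Fin.cons a r) := by
  rw [Finset.sum_comm, ← Finset.sum_product']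
  refine Finset.sum_nbij' (fun n => (n 0, Fin.tail n)) (fun p => Fin.cons p.1 p.2) ?_ ?_ ?_ ?_ ?_
  · intro n hn
    rw [Fintype.mem_piFinset, Fin.forall_fin_succ] at hn
    simpa [Fintype.mem_piFinset, Fin.tail] using hn
  · rintro ⟨a, r⟩ h
    rw [Fintype.mem_piFinset, Fin.forall_fin_succ]
    simpa [Fintype.mem_piFinset] using h
  · intro n _
    simp
  · intro p _
    simp
  · intro n _
    simp

theorem sum_prod_rpow_mul_one_div_abs_alphaRS_le {p : ℕ} (hp : 1 ≤ p) :
    ∃ C : ℝ, 0 < C ∧ ∀ y : ℝ, 2 ≤ y → ∀ i : Fin (p + 2) → Bool, i 0 = false →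
      ∑ n ∈ Fintype.piFinset (fun j : Fin (p + 2) =>
          if (j : ℕ) = 0 then Finset.Ioc ⌊y⌋₊ ⌊2 * ((p + 2 : ℕ) : ℝ) * y⌋₊
          else Finset.Icc 1 ⌊y⌋₊),
        (∏ j, (n j : ℝ) ^ (-(7 : ℝ) / 8)) *
          (if alphaRS n i ≠ 0 then 1 / |alphaRS n i| else 0) ≤
      C * y ^ ((4 : ℝ) ^ p - 5 / 4 + ((p + 2 : ℕ) : ℝ) / 8) := by
  set κ : ℝ := ((p + 2 : ℕ) : ℝ) with hκ
  have hκ1 : 1 ≤ κ := by rw [hκ]; push_cast; linarith [p.cast_nonneg (α := ℝ)]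
  set E : ℝ := (4 : ℝ) ^ p - 1 / 4 with hE
  have hE2 : 2 ≤ E := by
    have : (4 : ℝ) ^ 1 ≤ 4 ^ p := pow_le_pow_right₀ (by norm_num) hp
    rw [hE]
    linarith
  set N : ℕ := 4 ^ (p + 1) - 1 with hN
  have hNE : (1 : ℝ) / 4 * N = E := by
    rw [hN, Nat.cast_sub (Nat.one_le_pow _ _ (by norm_num))]
    push_cast
    rw [hE]
    ring
  set C₁ : ℝ := κ ^ N * (2 * κ) ^ E + 8 * (2 * κ) ^ 2 with hC₁
  refine ⟨C₁ * 8 ^ (p + 1), by positivity, fun y hy i hi => ?_⟩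
  have hy0 : 0 < y := by linarith
  set M : ℝ := 2 * κ * y with hM
  have hyM : y ≤ M := by nlinarith
  have hM1 : 1 ≤ M := by linarith
  set B : ℝ := κ * M ^ ((1 : ℝ) / 4) with hB
  have hB1 : 1 ≤ B := one_le_mul_of_one_le_of_one_le hκ1 (Real.one_le_rpow hM1 (by norm_num))
  set s : Finset ℕ := Finset.Ioc ⌊y⌋₊ ⌊M⌋₊ with hs
  set t : Finset ℕ := Finset.Icc 1 ⌊y⌋₊ with ht
  have hs_mem {a : ℕ} (ha : a ∈ s) : y ≤ a ∧ (a : ℝ) ≤ M := by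
    rw [hs, Finset.mem_Ioc] at ha
    exact ⟨((Nat.floor_lt hy0.le).1 ha.1).le, (Nat.le_floor_iff (by linarith)).1 ha.2⟩
  have ht_mem {b : ℕ} (hb : b ∈ t) : 1 ≤ b ∧ (b : ℝ) ≤ M := by
    rw [ht, Finset.mem_Icc] at hb
    exact ⟨hb.1, ((Nat.le_floor_iff hy0.le).1 hb.2).trans hyM⟩
  have hscard : (#s : ℝ) ≤ M := by
    rw [hs, Nat.card_Ioc]
    exact (Nat.cast_le.2 (Nat.sub_le _ _)).trans (Nat.floor_le (by linarith))
  have hDC : B ^ N + #s * (8 * M) ≤ C₁ * y ^ E := by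
    have h1 : B ^ N = κ ^ N * (2 * κ) ^ E * y ^ E := by
      rw [hB, mul_pow, ← Real.rpow_natCast (M ^ _), ← Real.rpow_mul (by linarith), hNE, hM,
        Real.mul_rpow (by positivity) hy0.le, mul_assoc]
    have h2 : y ^ 2 ≤ y ^ E := by
      rw [← Real.rpow_natCast]
      exact Real.rpow_le_rpow_of_exponent_le (by linarith) (by exact_mod_cast hE2)
    have h3 : #s * (8 * M) ≤ 8 * (2 * κ) ^ 2 * y ^ E := by
      calc #s * (8 * M) ≤ M * (8 * M) := by gcongr
        _ = 8 * (2 * κ) ^ 2 * y ^ 2 := by rw [hM]; ring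
        _ ≤ _ := by gcongr
    rw [h1, hC₁, add_mul]
    gcongr
  have hinner (r : Fin (p + 1) → ℕ) (hr : ∀ j, r j ∈ t) :
      ∑ a ∈ s, (∏ j, ((Fin.cons a r : Fin (p + 2) → ℕ) j : ℝ) ^ (-(7 : ℝ) / 8)) *
          (if alphaRS (Fin.cons a r) i ≠ 0 then 1 / |alphaRS (Fin.cons a r) i| else 0) ≤
        y ^ (-(7 : ℝ) / 8) * (C₁ * y ^ E) * ∏ j, (r j : ℝ) ^ (-(7 : ℝ) / 8) := by
    set A : ℝ := ∑ j, (if i (Fin.succ j) then (-1 : ℝ) else 1) * (r j : ℝ) ^ ((1 : ℝ) / 4) with hA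
    have hα (a : ℕ) : alphaRS (Fin.cons a r) i = (a : ℝ) ^ ((1 : ℝ) / 4) + A := by
      rw [alphaRS, Fin.sum_univ_succ]
      simp [hi, hA]
    have hlow : ∀ a ∈ s, (a : ℝ) ^ ((1 : ℝ) / 4) + A ≠ 0 →
        1 / |(a : ℝ) ^ ((1 : ℝ) / 4) + A| ≤ B ^ N := by
      intro a ha h0
      rw [← hα] at h0 ⊢
      rw [div_le_iff₀' (abs_pos.2 h0)]
      refine one_le_abs_sum_mul_pow _ _ (fun j => by split_ifs <;> norm_num) ?_ hB1 h0
      have hle : ∀ j, ((Fin.cons a r : Fin (p + 2) → ℕ) j : ℝ) ≤ M :=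
        Fin.cases (by simpa using (hs_mem ha).2) fun j => by simpa using (ht_mem (hr j)).2
      calc ∑ j, ((Fin.cons a r : Fin (p + 2) → ℕ) j : ℝ) ^ ((1 : ℝ) / 4)
          ≤ ∑ j : Fin (p + 2), M ^ ((1 : ℝ) / 4) :=
            Finset.sum_le_sum fun j _ =>
              Real.rpow_le_rpow (by positivity) (hle j) (by norm_num)
        _ = B := by rw [Finset.sum_const, Finset.card_univ, Fintype.card_fin, nsmul_eq_mul]
    have hsum := sum_one_div_abs_rpow_add_le (s := s) (A := A) (by linarith : 0 < M)
      (by positivity : 0 ≤ B ^ N)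
      (fun a ha => ⟨by exact_mod_cast (show (1 : ℝ) ≤ a by linarith [(hs_mem ha).1]),
        (hs_mem ha).2⟩) hlow
    simp only [hα]
    calc _ ≤ ∑ a ∈ s, y ^ (-(7 : ℝ) / 8) * (∏ j, (r j : ℝ) ^ (-(7 : ℝ) / 8)) *
          (if (a : ℝ) ^ ((1 : ℝ) / 4) + A ≠ 0 then
            1 / |(a : ℝ) ^ ((1 : ℝ) / 4) + A| else 0) := by
          refine Finset.sum_le_sum fun a ha => ?_
          rw [Fin.prod_univ_succ]
          simp only [Fin.cons_zero, Fin.cons_succ]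
          have := Real.rpow_le_rpow_of_nonpos hy0 (hs_mem ha).1
            (by norm_num : -(7 : ℝ) / 8 ≤ 0)
          gcongr
      _ ≤ y ^ (-(7 : ℝ) / 8) * (∏ j, (r j : ℝ) ^ (-(7 : ℝ) / 8)) * (C₁ * y ^ E) := by
          rw [← Finset.mul_sum]
          gcongr
          exact hsum.trans hDC
      _ = _ := by ring
  rw [sum_piFinset_cons]
  calc _ ≤ ∑ r ∈ Fintype.piFinset (fun _ : Fin (p + 1) => t),
        y ^ (-(7 : ℝ) / 8) * (C₁ * y ^ E) * ∏ j, (r j : ℝ) ^ (-(7 : ℝ) / 8) :=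
        Finset.sum_le_sum fun r hr => hinner r (Fintype.mem_piFinset.1 hr)
    _ = y ^ (-(7 : ℝ) / 8) * (C₁ * y ^ E) * (∑ b ∈ t, (b : ℝ) ^ (-(7 : ℝ) / 8)) ^ (p + 1) := by
        rw [← Finset.mul_sum, Finset.sum_prod_piFinset t fun _ b => (b : ℝ) ^ (-(7 : ℝ) / 8),
          Finset.prod_const, Finset.card_univ, Fintype.card_fin]
    _ ≤ y ^ (-(7 : ℝ) / 8) * (C₁ * y ^ E) * (8 * y ^ ((1 : ℝ) / 8)) ^ (p + 1) := by
        have h8 : ∑ b ∈ t, (b : ℝ) ^ (-(7 : ℝ) / 8) ≤ 8 * y ^ ((1 : ℝ) / 8) :=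
          (sum_Icc_rpow_neg_le _).trans (by gcongr; exact Nat.floor_le hy0.le)
        gcongr
    _ = C₁ * 8 ^ (p + 1) * y ^ ((4 : ℝ) ^ p - 5 / 4 + κ / 8) := by
        have : (4 : ℝ) ^ p - 5 / 4 + κ / 8 =
            -(7 : ℝ) / 8 + E + (1 : ℝ) / 8 * ((p + 1 : ℕ) : ℝ) := by
          rw [hE, hκ]; push_cast; ring
        rw [this, Real.rpow_add hy0, Real.rpow_add hy0, mul_pow,
          Real.rpow_mul hy0.le, Real.rpow_natCast]
        ring

theorem stmt_14 (c : ℕ → ℝ) (hc0 : ∀ n, 0 ≤ c n)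
    (hc : ∀ ε : ℝ, 0 < ε → ∃ K : ℝ, 0 < K ∧ ∀ n : ℕ, 1 ≤ n → c n ≤ K * (n : ℝ) ^ ε)
    (k : ℕ) (hk : k = 3 ∨ k = 4 ∨ k = 5) (ε : ℝ) (hε : 0 < ε) :
    ∃ C : ℝ, 0 < C ∧ ∀ T y : ℝ, 10 ≤ T → 2 ≤ y → y ≤ T →
      |∫ x in T..(2 * T),
          x ^ ((9 * k : ℝ) / 8) *
            ∑ i ∈ Finset.univ.filter (fun i : Fin k → Bool => i ⟨0, by omega⟩ = false),
              ∑ n ∈ Fintype.piFinset (fun j : Fin k =>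
                  if (j : ℕ) = 0 then Finset.Ioc ⌊y⌋₊ ⌊2 * (k : ℝ) * y⌋₊
                  else Finset.Icc 1 ⌊y⌋₊),
                (if (n ⟨0, by omega⟩ : ℝ) < 2 * (k : ℝ) * y ∧ alphaRS n i ≠ 0 then
                  ((∏ j, c (n j)) / (∏ j, (n j : ℝ)) ^ ((7 : ℝ) / 8)) *
                    Real.cos (8 * π * alphaRS n i * x ^ ((1 : ℝ) / 4) - π * betaRS i / 4)
                 else 0)| ≤
        C * T ^ (3 / 4 + 9 * (k : ℝ) / 8 + ε) * y ^ ((4 : ℝ) ^ (k - 2) - 5 / 4 + (k : ℝ) / 8) := by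
  obtain ⟨p, hp, rfl⟩ : ∃ p, 1 ≤ p ∧ k = p + 2 := ⟨k - 2, by omega, by omega⟩
  obtain ⟨C₀, hC₀, hsum⟩ := sum_prod_rpow_mul_one_div_abs_alphaRS_le hp
  rw [Nat.add_sub_cancel]
  set κ : ℝ := ((p + 2 : ℕ) : ℝ) with hκ
  have hκ1 : 1 ≤ κ := by rw [hκ]; push_cast; linarith [p.cast_nonneg (α := ℝ)]
  obtain ⟨K, hK, hcK⟩ := hc (ε / κ) (by positivity)
  set a : ℝ := 9 * κ / 8 with ha
  refine ⟨2 ^ (p + 2) * (K ^ (p + 2) * (2 * κ) ^ ε * 2 ^ (a + 3 / 4) * C₀), by positivity,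
    fun T y hT hy hyT => ?_⟩
  have hT0 : 0 < T := by linarith
  have hy0 : 0 < y := by linarith
  set M : ℝ := 2 * κ * y with hM
  have hyM : y ≤ M := by nlinarith
  set P := Fintype.piFinset (fun j : Fin (p + 2) =>
    if (j : ℕ) = 0 then Finset.Ioc ⌊y⌋₊ ⌊M⌋₊ else Finset.Icc 1 ⌊y⌋₊) with hP
  have hmem {n : Fin (p + 2) → ℕ} (hn : n ∈ P) (j) : 1 ≤ n j ∧ (n j : ℝ) ≤ M := by
    have := Fintype.mem_piFinset.1 hn j
    split_ifs at this
    · rw [Finset.mem_Ioc] at this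
      exact ⟨by omega, (Nat.le_floor_iff (by linarith)).1 this.2⟩
    · rw [Finset.mem_Icc] at this
      exact ⟨this.1, ((Nat.le_floor_iff hy0.le).1 this.2).trans hyM⟩
  set G : ℝ := K ^ (p + 2) * M ^ ε with hG
  have hcoef {n : Fin (p + 2) → ℕ} (hn : n ∈ P) :
      (∏ j, c (n j)) / (∏ j, (n j : ℝ)) ^ ((7 : ℝ) / 8) ≤
        G * ∏ j, (n j : ℝ) ^ (-(7 : ℝ) / 8) := by
    have h1 : ∏ j, c (n j) ≤ G := by
      calc ∏ j, c (n j) ≤ ∏ _j : Fin (p + 2), K * M ^ (ε / κ) := by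
            refine Finset.prod_le_prod (fun j _ => hc0 _) fun j _ => ?_
            have := hmem hn j
            refine (hcK _ this.1).trans ?_
            have := this.2
            gcongr
        _ = G := by
            rw [Finset.prod_const, Finset.card_univ, Fintype.card_fin, mul_pow, hG,
              ← Real.rpow_natCast (M ^ _), ← Real.rpow_mul (by positivity), ← hκ,
              div_mul_cancel₀ _ (by positivity)]
    rw [Real.finsetProd_rpow _ _ fun j _ => Nat.cast_nonneg _, neg_div,
      Real.rpow_neg (Finset.prod_nonneg fun j _ => Nat.cast_nonneg _), ← div_eq_mul_inv]
    gcongr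
  set summand : (Fin (p + 2) → Bool) → (Fin (p + 2) → ℕ) → ℝ → ℝ := fun i n x =>
    x ^ a * (if (n ⟨0, by omega⟩ : ℝ) < M ∧ alphaRS n i ≠ 0 then
      ((∏ j, c (n j)) / (∏ j, (n j : ℝ)) ^ ((7 : ℝ) / 8)) *
        Real.cos (8 * π * alphaRS n i * x ^ ((1 : ℝ) / 4) - π * betaRS i / 4) else 0) with hterm
  have hsummand_int (i n) : IntervalIntegrable (summand i n) MeasureTheory.volume T (2 * T) := by
    have hc (b : ℝ) : ContinuousOn (fun x : ℝ => x ^ b) (Set.uIcc T (2 * T)) := by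
      intro x hx
      rw [Set.uIcc_of_le (by linarith)] at hx
      exact (Real.continuousAt_rpow_const _ _
        (Or.inl (by linarith [hx.1] : 0 < x).ne')).continuousWithinAt
    refine ContinuousOn.intervalIntegrable ((hc a).mul ?_)
    split_ifs
    · exact continuousOn_const.mul (Real.continuous_cos.comp_continuousOn
        (((hc _).const_mul _).sub continuousOn_const))
    · exact continuousOn_const
  have hsum_int (i) : IntervalIntegrable (fun x => ∑ n ∈ P, summand i n x)
      MeasureTheory.volume T (2 * T) := by
    have := IntervalIntegrable.sum P fun n _ => hsummand_int i n
    rwa [show ∑ n ∈ P, summand i n = fun x => ∑ n ∈ P, summand i n x from by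
      ext x; exact Finset.sum_apply _ _ _] at this
  have hbound (i) {n} (hn : n ∈ P) : |∫ x in T..(2 * T), summand i n x| ≤
      G * (2 * T) ^ (a + 3 / 4) * ((∏ j, (n j : ℝ) ^ (-(7 : ℝ) / 8)) *
        (if alphaRS n i ≠ 0 then 1 / |alphaRS n i| else 0)) := by
    by_cases h : (n ⟨0, by omega⟩ : ℝ) < M ∧ alphaRS n i ≠ 0
    · simp only [hterm, if_pos h, if_pos h.2]
      simp only [mul_left_comm _ ((∏ j, c (n j)) / _)]
      have hw : 0 ≤ (∏ j, c (n j)) / (∏ j, (n j : ℝ)) ^ ((7 : ℝ) / 8) :=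
        div_nonneg (Finset.prod_nonneg fun j _ => hc0 _) (by positivity)
      rw [intervalIntegral.integral_const_mul, abs_mul, abs_of_nonneg hw]
      calc _ ≤ (G * ∏ j, (n j : ℝ) ^ (-(7 : ℝ) / 8)) *
            ((2 * T) ^ (a + 3 / 4) * (1 / |alphaRS n i|)) :=
            mul_le_mul (hcoef hn) (abs_integral_rpow_mul_cos_le (by positivity) h.2 hT0)
              (abs_nonneg _) (by positivity)
        _ = _ := by ring
    · simp only [hterm, if_neg h, mul_zero, intervalIntegral.integral_zero, abs_zero]
      have : 0 ≤ if alphaRS n i ≠ 0 then 1 / |alphaRS n i| else 0 := by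
        split_ifs <;> positivity
      positivity
  simp only [Finset.mul_sum]
  rw [intervalIntegral.integral_finsetSum fun i _ => hsum_int i]
  have hstep (i : Fin (p + 2) → Bool) (hi : i 0 = false) :
      |∫ x in T..(2 * T), ∑ n ∈ P, summand i n x| ≤
        G * (2 * T) ^ (a + 3 / 4) * (C₀ * y ^ ((4 : ℝ) ^ p - 5 / 4 + κ / 8)) := by
    rw [intervalIntegral.integral_finsetSum fun n _ => hsummand_int i n]
    refine (Finset.abs_sum_le_sum_abs _ _).trans
      ((Finset.sum_le_sum fun n hn => hbound i hn).trans ?_)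
    rw [← Finset.mul_sum]
    exact mul_le_mul_of_nonneg_left (hsum y hy i hi) (by positivity)
  refine (Finset.abs_sum_le_sum_abs _ _).trans ((Finset.sum_le_card_nsmul _ _ _ fun i hi =>
    hstep i (Finset.mem_filter.1 hi).2).trans ?_)
  rw [nsmul_eq_mul]
  have hcard : (#(Finset.univ.filter fun i : Fin (p + 2) → Bool => i ⟨0, by omega⟩ = false) : ℝ) ≤
      2 ^ (p + 2) := by
    have := Finset.card_filter_le (Finset.univ : Finset (Fin (p + 2) → Bool))
      fun i => i ⟨0, by omega⟩ = false
    rw [Finset.card_univ, Fintype.card_fun, Fintype.card_fin, Fintype.card_bool] at this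
    exact_mod_cast this
  have hMT : M ^ ε ≤ (2 * κ) ^ ε * T ^ ε := by
    rw [← Real.mul_rpow (by positivity) hT0.le, hM]
    gcongr
  have hexp : T ^ (3 / 4 + a + ε) = T ^ (a + 3 / 4) * T ^ ε := by
    rw [add_comm (3 / 4) a, Real.rpow_add hT0]
  calc _ ≤ 2 ^ (p + 2) * (K ^ (p + 2) * ((2 * κ) ^ ε * T ^ ε) * (2 * T) ^ (a + 3 / 4) *
        (C₀ * y ^ ((4 : ℝ) ^ p - 5 / 4 + κ / 8))) := by
        rw [hG]
        gcongr
        exact hcard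
    _ = _ := by
        rw [hexp, Real.mul_rpow (by norm_num) hT0.le]
        ring
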